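/- Let H be a complex Hilbert space, let a ∈ C_1(H), let ε > 0, and let e be a minimal partial isometry on H. Then there exists a finite-rank orthogonal projection p on H such that p e = e p = e, ‖p a p‖_∞ = ‖a‖_∞, and ‖a − p a p‖₁ ≤ ε, where ‖·‖_∞ denotes the operator norm and ‖·‖₁ the trace norm. -/

import Mathlib

/-! Setting: `H` is a complex Hilbert space, and we consider the space `C₁(H)` of trace class
operators on `H` (more generally the Schatten classes `C_p(H)`), regarded as those bounded
operators `a : H →L[ℂ] H` that are compact and whose sequence of singular values is
`p`-summable. The singular values `μₙ(a)` of a compact operator `a` (the eigenvalues of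
`|a| = (a^* a)^(1/2)` arranged in decreasing order and repeated according to multiplicity)
are realized here via the approximation numbers, which coincide with them. -/

/-- `sValue a n` is the `n`-th approximation number (`0`-indexed) of `a`, namely the distance
from `a` to the operators of rank at most `n`.  For a compact operator on a Hilbert space this
coincides with the `(n+1)`-th singular value `μ_{n+1}(a)`, i.e. the `(n+1)`-th eigenvalue of
`|a| = (a^* a)^(1/2)` arranged in decreasing order and repeated according to multiplicity.  In
particular `sValue a 0 = μ₁(a) = ‖a‖`. -/
noncomputable def sValue {H : Type*} [NormedAddCommGroup H] [InnerProductSpace ℂ H]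
    (a : H →L[ℂ] H) (n : ℕ) : ℝ :=
  sInf {r : ℝ | ∃ F : H →L[ℂ] H, LinearMap.rank (F : H →ₗ[ℂ] H) ≤ (n : Cardinal) ∧ r = ‖a - F‖}

/-- Membership in the Schatten class `C_p(H)`: `a` is a compact operator with
`‖a‖_p^p = ∑ₙ μₙ(a)^p < ∞`. -/
def MemSchatten {H : Type*} [NormedAddCommGroup H] [InnerProductSpace ℂ H]
    (p : ℝ) (a : H →L[ℂ] H) : Prop :=
  IsCompactOperator a ∧ Summable (fun n => sValue a n ^ p)

/-- Membership in the trace class `C₁(H)`: `a` is a compact operator with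
`‖a‖₁ = tr |a| = ∑ₙ μₙ(a) < ∞`. -/
def MemTraceClass {H : Type*} [NormedAddCommGroup H] [InnerProductSpace ℂ H]
    (a : H →L[ℂ] H) : Prop :=
  IsCompactOperator a ∧ Summable (fun n => sValue a n)

/-- The trace norm `‖a‖₁ = tr |a| = ∑ₙ μₙ(a)`. -/
noncomputable def traceNorm {H : Type*} [NormedAddCommGroup H] [InnerProductSpace ℂ H]
    (a : H →L[ℂ] H) : ℝ :=
  ∑' n, sValue a n

/-- The closed unit ball of `C₁(H)` with respect to the trace norm `‖·‖₁`. -/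
def traceBall (H : Type*) [NormedAddCommGroup H] [InnerProductSpace ℂ H] :
    Set (H →L[ℂ] H) :=
  {x | MemTraceClass x ∧ traceNorm x ≤ 1}

/-- The λ-function of Aron and Lohman on the closed unit ball of `C₁(H)`:
`λ(a) = sup { t : (e, y, t) ∈ ∂ₑ(B) × B × [0,1] is a triplet amenable to a }`,
where a triplet `(e, y, t)` is amenable to `a` when `a = t • e + (1 - t) • y`. -/
noncomputable def lambdaFn {H : Type*} [NormedAddCommGroup H] [InnerProductSpace ℂ H]
    (a : H →L[ℂ] H) : ℝ :=
  sSup {t : ℝ | t ∈ Set.Icc (0 : ℝ) 1 ∧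
    ∃ e ∈ Set.extremePoints ℝ (traceBall H), ∃ y ∈ traceBall H, a = t • e + (1 - t) • y}

/-- A minimal (i.e. rank-one) partial isometry: `e e^* e = e` and `e` has rank one. -/
def IsMinimalPartialIsometry {H : Type*} [NormedAddCommGroup H] [InnerProductSpace ℂ H]
    [CompleteSpace H] (e : H →L[ℂ] H) : Prop :=
  e ∘L (ContinuousLinearMap.adjoint e) ∘L e = e ∧ LinearMap.rank (e : H →ₗ[ℂ] H) = 1

/-- The rank one operator `η ⊗ ξ : ζ ↦ ⟨ζ, ξ⟩ η` (Mathlib's inner product being conjugate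
linear in the first variable, this is `ζ ↦ ⟪ξ, ζ⟫ • η`). -/
noncomputable def rankOneOp {H : Type*} [NormedAddCommGroup H] [InnerProductSpace ℂ H]
    (η ξ : H) : H →L[ℂ] H :=
  (innerSL ℂ ξ).smulRight η

theorem norm_compression_le {H : Type*} [NormedAddCommGroup H] [InnerProductSpace ℂ H]
    (a P : H →L[ℂ] H) (hP : ‖P‖ ≤ 1) : ‖P ∘L a ∘L P‖ ≤ ‖a‖ :=
  calc ‖P ∘L a ∘L P‖ ≤ ‖P‖ * (‖a‖ * ‖P‖) :=
        (P.opNorm_comp_le _).trans (by gcongr; exact a.opNorm_comp_le P)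
    _ ≤ 1 * (‖a‖ * 1) := by gcongr
    _ = ‖a‖ := by ring

/-- Dominating the approximation numbers of `a - P a P` by those of `a`, for a contraction `P`. -/
theorem sValue_sub_compression_le {H : Type*} [NormedAddCommGroup H] [InnerProductSpace ℂ H]
    (a P : H →L[ℂ] H) (hP : ‖P‖ ≤ 1) (n : ℕ) :
    sValue (a - P ∘L a ∘L P) n ≤ 2 * sValue a (n / 2) := by
  have hbound : sValue (a - P ∘L a ∘L P) n / 2 ≤ sValue a (n / 2) := by
    refine le_csInf ⟨‖a - 0‖, 0, by simp, rfl⟩ ?_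
    rintro r ⟨F, hF, rfl⟩
    have hrank : LinearMap.rank ((F + (-P) ∘L F ∘L P : H →L[ℂ] H) : H →ₗ[ℂ] H)
        ≤ (n : Cardinal) := by
      have hcomp : LinearMap.rank (((-P) ∘L F ∘L P : H →L[ℂ] H) : H →ₗ[ℂ] H)
          ≤ ((n / 2 : ℕ) : Cardinal) :=
        (LinearMap.rank_comp_le_right ((F ∘L P : H →L[ℂ] H) : H →ₗ[ℂ] H)
          ((-P : H →L[ℂ] H) : H →ₗ[ℂ] H)).trans
          ((LinearMap.rank_comp_le_left (P : H →ₗ[ℂ] H) (F : H →ₗ[ℂ] H)).trans hF)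
      refine (LinearMap.rank_add_le (F : H →ₗ[ℂ] H) _).trans ((add_le_add hF hcomp).trans ?_)
      norm_cast
      omega
    have hle : sValue (a - P ∘L a ∘L P) n ≤
        ‖a - P ∘L a ∘L P - (F + (-P) ∘L F ∘L P)‖ :=
      csInf_le ⟨0, by rintro _ ⟨_, _, rfl⟩; exact norm_nonneg _⟩ ⟨_, hrank, rfl⟩
    have heq : a - P ∘L a ∘L P - (F + (-P) ∘L F ∘L P) = (a - F) - P ∘L (a - F) ∘L P := by
      ext x; simp; abel
    rw [heq] at hle
    have := norm_sub_le (a - F) (P ∘L (a - F) ∘L P)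
    have := norm_compression_le (a - F) P hP
    linarith
  linarith

theorem sValue_nonneg {H : Type*} [NormedAddCommGroup H] [InnerProductSpace ℂ H]
    (a : H →L[ℂ] H) (n : ℕ) : 0 ≤ sValue a n :=
  Real.sInf_nonneg (by rintro _ ⟨_, _, rfl⟩; exact norm_nonneg _)

theorem sValue_le_norm {H : Type*} [NormedAddCommGroup H] [InnerProductSpace ℂ H]
    (a : H →L[ℂ] H) (n : ℕ) : sValue a n ≤ ‖a‖ :=
  csInf_le ⟨0, by rintro _ ⟨_, _, rfl⟩; exact norm_nonneg _⟩ ⟨0, by simp, by simp⟩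

/-- A compact operator on a Hilbert space attains its norm. -/
theorem IsCompactOperator.exists_norm_mul_le_norm_apply {H : Type*} [NormedAddCommGroup H]
    [InnerProductSpace ℂ H] [CompleteSpace H] {a : H →L[ℂ] H} (ha : IsCompactOperator a)
    (h0 : a ≠ 0) : ∃ w : H, w ≠ 0 ∧ ‖a‖ * ‖w‖ ≤ ‖a w‖ := by
  have hK : IsCompact (closure (a '' Metric.closedBall 0 1)) :=
    ha.isCompact_closure_image_closedBall 1
  obtain ⟨z, hz, hmax⟩ := hK.exists_isMaxOn
    ⟨a 0, subset_closure ⟨0, by simp, rfl⟩⟩ continuous_norm.continuousOn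
  have hnorm : ‖a‖ ≤ ‖z‖ := by
    refine a.opNorm_le_of_unit_norm (norm_nonneg z) fun x hx => ?_
    exact hmax (subset_closure ⟨x, by simp [hx], rfl⟩)
  have hz0 : 0 < ‖z‖ := (norm_pos_iff.mpr h0).trans_le hnorm
  set w := ContinuousLinearMap.adjoint a z with hw
  have hball : closure (a '' Metric.closedBall 0 1) ⊆ {y | ‖inner ℂ z y‖ ≤ ‖w‖} := by
    refine closure_minimal ?_ (isClosed_le (by fun_prop) continuous_const)
    rintro _ ⟨x, hx, rfl⟩
    have hx1 : ‖x‖ ≤ 1 := by simpa using hx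
    rw [Set.mem_ofPred_eq, ← ContinuousLinearMap.adjoint_inner_left, ← hw]
    exact (norm_inner_le_norm w x).trans (mul_le_of_le_one_right (norm_nonneg w) hx1)
  have hzw : ‖z‖ * ‖z‖ ≤ ‖w‖ := by
    have := hball hz
    rwa [Set.mem_ofPred_eq, inner_self_eq_norm_sq_to_K, norm_pow, RCLike.norm_ofReal, abs_norm, sq] at this
  have hww : ‖w‖ * ‖w‖ ≤ ‖z‖ * ‖a w‖ := by
    have h1 := norm_inner_le_norm (𝕜 := ℂ) z (a w)
    rwa [← ContinuousLinearMap.adjoint_inner_left, ← hw, inner_self_eq_norm_sq_to_K, norm_pow, RCLike.norm_ofReal, abs_norm, sq] at h1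
  have hw0 : 0 < ‖w‖ := (mul_pos hz0 hz0).trans_le hzw
  refine ⟨w, norm_pos_iff.mp hw0, ?_⟩
  nlinarith [mul_le_mul_of_nonneg_left hzw hw0.le, mul_le_mul_of_nonneg_right hnorm hw0.le]

/-- The adjoint of a finite-rank operator has finite rank. -/
theorem finiteDimensional_range_adjoint {H : Type*} [NormedAddCommGroup H]
    [InnerProductSpace ℂ H] [CompleteSpace H] (F : H →L[ℂ] H)
    [FiniteDimensional ℂ (LinearMap.range (F : H →ₗ[ℂ] H))] :
    FiniteDimensional ℂ
      (LinearMap.range (ContinuousLinearMap.adjoint F : H →ₗ[ℂ] H)) := by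
  set V := LinearMap.range (F : H →ₗ[ℂ] H) with hV
  have hF : V.starProjection ∘L F = F := by
    ext x
    exact Submodule.starProjection_eq_self_iff.mpr ⟨x, rfl⟩
  have hadj : ContinuousLinearMap.adjoint F ∘L V.starProjection =
      ContinuousLinearMap.adjoint F := by
    conv_rhs => rw [← hF, ContinuousLinearMap.adjoint_comp]
    rw [(isSelfAdjoint_starProjection V).adjoint_eq]
  refine Submodule.finiteDimensional_of_le (S₂ := V.map
    (ContinuousLinearMap.adjoint F : H →ₗ[ℂ] H)) ?_
  rintro _ ⟨x, rfl⟩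
  refine ⟨V.starProjection x, V.starProjection_apply_mem x, ?_⟩
  exact DFunLike.congr_fun hadj x

/-- An orthogonal projection is a right identity for `F` once its range contains that of the
adjoint of `F`. -/
theorem comp_starProjection_eq_self {H : Type*} [NormedAddCommGroup H]
    [InnerProductSpace ℂ H] [CompleteSpace H] (F : H →L[ℂ] H) (V : Submodule ℂ H)
    [V.HasOrthogonalProjection]
    (h : LinearMap.range (ContinuousLinearMap.adjoint F : H →ₗ[ℂ] H) ≤ V) :
    F ∘L V.starProjection = F := by
  apply ContinuousLinearMap.adjoint.injective
  rw [ContinuousLinearMap.adjoint_comp, (isSelfAdjoint_starProjection V).adjoint_eq]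
  ext x
  exact Submodule.starProjection_eq_self_iff.mpr (h ⟨x, rfl⟩)

theorem finiteDimensional_range_of_rank_le {H : Type*} [NormedAddCommGroup H]
    [InnerProductSpace ℂ H] {F : H →L[ℂ] H} {n : ℕ}
    (h : LinearMap.rank (F : H →ₗ[ℂ] H) ≤ (n : Cardinal)) :
    FiniteDimensional ℂ (LinearMap.range (F : H →ₗ[ℂ] H)) :=
  Module.rank_lt_aleph0_iff.mp (h.trans_lt (Cardinal.natCast_lt_aleph0))

/-- Finite-rank compressions approximate a norm limit of finite-rank operators in operator norm,
the projection being taken above a prescribed finite-dimensional subspace. -/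
theorem exists_norm_sub_compression_le {H : Type*} [NormedAddCommGroup H]
    [InnerProductSpace ℂ H] [CompleteSpace H] {a : H →L[ℂ] H}
    (ha : Filter.Tendsto (sValue a) Filter.atTop (nhds 0)) (W : Submodule ℂ H)
    [FiniteDimensional ℂ W] {δ : ℝ} (hδ : 0 < δ) :
    ∃ V : Submodule ℂ H, ∃ _ : FiniteDimensional ℂ V, W ≤ V ∧
      ‖a - V.starProjection ∘L a ∘L V.starProjection‖ ≤ δ := by
  obtain ⟨n, hn⟩ := (ha.eventually_lt_const (half_pos hδ)).exists
  obtain ⟨_, ⟨F, hF, rfl⟩, hlt⟩ :=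
    exists_lt_of_csInf_lt (by exact ⟨‖a - 0‖, 0, by simp, rfl⟩) hn
  have := finiteDimensional_range_of_rank_le hF
  have := finiteDimensional_range_adjoint F
  set R := LinearMap.range (F : H →ₗ[ℂ] H) with hR
  set R' := LinearMap.range (ContinuousLinearMap.adjoint F : H →ₗ[ℂ] H) with hR'
  refine ⟨W ⊔ (R ⊔ R'), inferInstance, le_sup_left, ?_⟩
  set V := W ⊔ (R ⊔ R') with hV
  set P := V.starProjection with hP
  have hFP : F ∘L P = F :=
    comp_starProjection_eq_self F V (le_sup_right.trans le_sup_right)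
  have hPF : P ∘L F = F := by
    ext x
    exact Submodule.starProjection_eq_self_iff.mpr
      ((le_sup_left.trans le_sup_right : R ≤ V) ⟨x, rfl⟩)
  have heq : a - P ∘L a ∘L P = (a - F) - P ∘L (a - F) ∘L P := by
    have : P ∘L (a - F) ∘L P = P ∘L a ∘L P - F := by
      rw [ContinuousLinearMap.sub_comp, ContinuousLinearMap.comp_sub, hFP, hPF]
    rw [this]; abel
  rw [heq]
  have := norm_sub_le (a - F) (P ∘L (a - F) ∘L P)
  have := norm_compression_le (a - F) P V.starProjection_norm_le
  linarith

/-- Finite-rank compressions approximate a trace class operator in trace norm, the projection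
being taken above a prescribed finite-dimensional subspace. -/
theorem MemTraceClass.exists_traceNorm_sub_compression_le {H : Type*} [NormedAddCommGroup H]
    [InnerProductSpace ℂ H] [CompleteSpace H] {a : H →L[ℂ] H} (ha : MemTraceClass a)
    (W : Submodule ℂ H) [FiniteDimensional ℂ W] {ε : ℝ} (hε : 0 < ε) :
    ∃ V : Submodule ℂ H, ∃ _ : FiniteDimensional ℂ V, W ≤ V ∧
      traceNorm (a - V.starProjection ∘L a ∘L V.starProjection) ≤ ε := by
  choose V hV hWV hle using fun j : ℕ =>
    exists_norm_sub_compression_le ha.2.tendsto_atTop_zero W (Nat.one_div_pos_of_nat (n := j))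
  have hsum : Summable fun n : ℕ => 2 * sValue a (n / 2) := by
    refine Summable.mul_left 2 ?_
    have heven : HasSum (fun k => sValue a (2 * k / 2)) (∑' n, sValue a n) := by
      simpa using ha.2.hasSum
    have hodd : HasSum (fun k => sValue a ((2 * k + 1) / 2)) (∑' n, sValue a n) := by
      convert ha.2.hasSum using 3
      omega
    exact (HasSum.even_add_odd (f := fun n => sValue a (n / 2)) heven hodd).summable
  have hlim := tendsto_tsum_of_dominated_convergence (𝓕 := Filter.atTop)
    (f := fun j n => sValue (a - (V j).starProjection ∘L a ∘L (V j).starProjection) n)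
    (g := fun _ => 0) hsum
    (fun n => squeeze_zero (fun j => sValue_nonneg _ _)
      (fun j => (sValue_le_norm _ _).trans (hle j)) tendsto_one_div_add_atTop_nhds_zero_nat)
    (Filter.Eventually.of_forall fun j n => by
      rw [Real.norm_of_nonneg (sValue_nonneg _ _)]
      exact sValue_sub_compression_le a _ (V j).starProjection_norm_le n)
  rw [tsum_zero] at hlim
  obtain ⟨j, hj⟩ := (hlim.eventually_lt_const hε).exists
  exact ⟨V j, hV j, hWV j, hj.le⟩

/-- Compressing by a projection whose range contains a norm-attaining vector and its image
preserves the norm. -/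
theorem norm_compression_eq {H : Type*} [NormedAddCommGroup H] [InnerProductSpace ℂ H]
    {a : H →L[ℂ] H} {V : Submodule ℂ H} [V.HasOrthogonalProjection] {w : H} (hw0 : w ≠ 0)
    (hw : ‖a‖ * ‖w‖ ≤ ‖a w‖) (hwV : w ∈ V) (hawV : a w ∈ V) :
    ‖V.starProjection ∘L a ∘L V.starProjection‖ = ‖a‖ := by
  refine le_antisymm (norm_compression_le _ _ V.starProjection_norm_le) ?_
  have h := (V.starProjection ∘L a ∘L V.starProjection).le_opNorm w
  rw [ContinuousLinearMap.comp_apply, ContinuousLinearMap.comp_apply,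
    Submodule.starProjection_eq_self_iff.mpr hwV,
    Submodule.starProjection_eq_self_iff.mpr hawV] at h
  exact le_of_mul_le_mul_right (hw.trans h) (norm_pos_iff.mpr hw0)

/-- Let `H` be a complex Hilbert space, `a ∈ C₁(H)`, `ε > 0`, and let `e`
be a minimal partial isometry on `H`. Then there exists a finite-rank orthogonal projection
`P` on `H` such that `P e = e P = e`, `‖P a P‖_∞ = ‖a‖_∞` and `‖a - P a P‖₁ ≤ ε`. -/
theorem exists_finite_rank_projection_approx {H : Type*} [NormedAddCommGroup H]
    [InnerProductSpace ℂ H] [CompleteSpace H] (a : H →L[ℂ] H) (ha : MemTraceClass a)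
    (ε : ℝ) (hε : 0 < ε) (e : H →L[ℂ] H) (he : IsMinimalPartialIsometry e) :
    ∃ P : H →L[ℂ] H, IsSelfAdjoint P ∧ P ∘L P = P ∧
      FiniteDimensional ℂ (LinearMap.range (P : H →ₗ[ℂ] H)) ∧
      P ∘L e = e ∧ e ∘L P = e ∧ ‖P ∘L a ∘L P‖ = ‖a‖ ∧
      traceNorm (a - P ∘L a ∘L P) ≤ ε := by
  have hfin : FiniteDimensional ℂ (LinearMap.range (e : H →ₗ[ℂ] H)) :=
    finiteDimensional_range_of_rank_le (n := 1) (by simp [he.2])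
  have hfin' := finiteDimensional_range_adjoint e
  obtain ⟨w, hw⟩ : ∃ w : H, a ≠ 0 → w ≠ 0 ∧ ‖a‖ * ‖w‖ ≤ ‖a w‖ := by
    by_cases h0 : a = 0
    · exact ⟨0, fun h => absurd h0 h⟩
    · exact (ha.1.exists_norm_mul_le_norm_apply h0).imp fun w hw _ => hw
  have hpair : FiniteDimensional ℂ (Submodule.span ℂ {w, a w}) :=
    FiniteDimensional.span_of_finite ℂ (Set.toFinite _)
  obtain ⟨V, hV, hWV, hle⟩ := ha.exists_traceNorm_sub_compression_le
    (Submodule.span ℂ {w, a w} ⊔ (LinearMap.range (e : H →ₗ[ℂ] H) ⊔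
      LinearMap.range (ContinuousLinearMap.adjoint e : H →ₗ[ℂ] H))) hε
  obtain ⟨hspan, hrange, hrange'⟩ := by simpa only [sup_le_iff] using hWV
  refine ⟨V.starProjection, isSelfAdjoint_starProjection V,
    V.isIdempotentElem_starProjection, ?_, ?_, comp_starProjection_eq_self e V hrange', ?_, hle⟩
  · rw [Submodule.range_starProjection]
    exact hV
  · ext x
    exact Submodule.starProjection_eq_self_iff.mpr (hrange ⟨x, rfl⟩)
  · by_cases h0 : a = 0
    · simp [h0]
    · exact norm_compression_eq (hw h0).1 (hw h0).2
        (hspan (Submodule.subset_span (by simp))) (hspan (Submodule.subset_span (by simp)))
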